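/- Let A ∈ ℝ^{n×n}, B ∈ ℝ^{n×p}, E ∈ ℝ^{n×q}, C ∈ ℝ^{m×n}, F ∈ ℝ^{m×q}, let M ∈ ℝ^{n×n} be symmetric positive definite, L ∈ ℝ^{p×n}, and let Q ∈ ℝ^{m×m} be symmetric with −Q positive definite, R ∈ ℝ^{q×q} symmetric, S ∈ ℝ^{m×q}. Suppose the symmetric block matrix [ −(AM + MAᵀ + BL + LᵀBᵀ) , −E + MCᵀS , MCᵀ ; −Eᵀ + SᵀCM , FᵀS + SᵀF + R , Fᵀ ; CM , F , −Q⁻¹ ] is positive semidefinite. Then with state feedback gain K := L M⁻¹, the closed-loop system ẋ = (A + BK)x + Ew, y = Cx + Fw is (Q,S,R)-dissipative from the disturbance w to the output y with storage function V(x) = xᵀM⁻¹x: for every continuous w : ℝ → ℝ^{q}, every differentiable x : ℝ → ℝⁿ with x′(t) = (A + BK)x(t) + E w(t) for all t, y(t) := C x(t) + F w(t), and all t₀ ≤ t₁: x(t₁)ᵀM⁻¹x(t₁) − x(t₀)ᵀM⁻¹x(t₀) ≤ ∫_{t₀}^{t₁} ( y(t)ᵀQ y(t) + 2 y(t)ᵀ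 S w(t) + w(t)ᵀ R w(t) ) dt. -/

import Mathlib

open Matrix intervalIntegral

/-- The dissipativate-ability LMI
`[ -(AM + MAᵀ + BL + LᵀBᵀ) , -E + MCᵀS , MCᵀ ; -Eᵀ + SᵀCM , FᵀS + SᵀF + R , Fᵀ ;
   CM , F , -Q⁻¹ ]`. -/
noncomputable def dissipativateLMI {n p q m : ℕ}
    (A : Matrix (Fin n) (Fin n) ℝ) (B : Matrix (Fin n) (Fin p) ℝ)
    (E : Matrix (Fin n) (Fin q) ℝ) (C : Matrix (Fin m) (Fin n) ℝ)
    (F : Matrix (Fin m) (Fin q) ℝ) (M : Matrix (Fin n) (Fin n) ℝ)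
    (L : Matrix (Fin p) (Fin n) ℝ) (Q : Matrix (Fin m) (Fin m) ℝ)
    (S : Matrix (Fin m) (Fin q) ℝ) (R : Matrix (Fin q) (Fin q) ℝ) :
    Matrix (Fin n ⊕ Fin q ⊕ Fin m) (Fin n ⊕ Fin q ⊕ Fin m) ℝ :=
  Matrix.of fun i j =>
    match i, j with
    | Sum.inl a, Sum.inl b => (-(A * M + M * Aᵀ + B * L + Lᵀ * Bᵀ)) a b
    | Sum.inl a, Sum.inr (Sum.inl b) => (-E + M * Cᵀ * S) a b
    | Sum.inl a, Sum.inr (Sum.inr b) => (M * Cᵀ) a b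
    | Sum.inr (Sum.inl a), Sum.inl b => (-Eᵀ + Sᵀ * C * M) a b
    | Sum.inr (Sum.inl a), Sum.inr (Sum.inl b) => (Fᵀ * S + Sᵀ * F + R) a b
    | Sum.inr (Sum.inl a), Sum.inr (Sum.inr b) => Fᵀ a b
    | Sum.inr (Sum.inr a), Sum.inl b => (C * M) a b
    | Sum.inr (Sum.inr a), Sum.inr (Sum.inl b) => F a b
    | Sum.inr (Sum.inr a), Sum.inr (Sum.inr b) => (-(Q⁻¹)) a b

theorem dissipativateLMI_eq_fromBlocks {n p q m : ℕ}
    (A : Matrix (Fin n) (Fin n) ℝ) (B : Matrix (Fin n) (Fin p) ℝ)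
    (E : Matrix (Fin n) (Fin q) ℝ) (C : Matrix (Fin m) (Fin n) ℝ)
    (F : Matrix (Fin m) (Fin q) ℝ) (M : Matrix (Fin n) (Fin n) ℝ)
    (L : Matrix (Fin p) (Fin n) ℝ) (Q : Matrix (Fin m) (Fin m) ℝ)
    (S : Matrix (Fin m) (Fin q) ℝ) (R : Matrix (Fin q) (Fin q) ℝ) :
    dissipativateLMI A B E C F M L Q S R =
      fromBlocks (-(A * M + M * Aᵀ + B * L + Lᵀ * Bᵀ))
        (fromCols (-E + M * Cᵀ * S) (M * Cᵀ))
        (fromRows (-Eᵀ + Sᵀ * C * M) (C * M))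
        (fromBlocks (Fᵀ * S + Sᵀ * F + R) Fᵀ F (-(Q⁻¹))) := by
  ext (i | i | i) (j | j | j) <;> rfl

/-- The quadratic form of the LMI matrix at `(z, u, Q y)` with `y = C M z + F u` is the supply
rate at `(y, u)` minus the derivative of the storage function. -/
theorem dissipativateLMI_quadraticForm {n p q m : ℕ}
    (A : Matrix (Fin n) (Fin n) ℝ) (B : Matrix (Fin n) (Fin p) ℝ)
    (E : Matrix (Fin n) (Fin q) ℝ) (C : Matrix (Fin m) (Fin n) ℝ)
    (F : Matrix (Fin m) (Fin q) ℝ) {M : Matrix (Fin n) (Fin n) ℝ} (hM : M.IsSymm)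
    (L : Matrix (Fin p) (Fin n) ℝ) {Q : Matrix (Fin m) (Fin m) ℝ} (hQ : IsUnit Q.det)
    (S : Matrix (Fin m) (Fin q) ℝ) (R : Matrix (Fin q) (Fin q) ℝ)
    (z : Fin n → ℝ) (u : Fin q → ℝ) (y : Fin m → ℝ) (hy : y = C *ᵥ M *ᵥ z + F *ᵥ u) :
    Sum.elim z (Sum.elim u (Q *ᵥ y)) ⬝ᵥ
        dissipativateLMI A B E C F M L Q S R *ᵥ Sum.elim z (Sum.elim u (Q *ᵥ y)) =
      y ⬝ᵥ Q *ᵥ y + 2 * (y ⬝ᵥ S *ᵥ u) + u ⬝ᵥ R *ᵥ u -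
        2 * (z ⬝ᵥ (A *ᵥ M *ᵥ z + B *ᵥ L *ᵥ z + E *ᵥ u)) := by
  have hQy : Q⁻¹ *ᵥ Q *ᵥ y = y := by
    rw [mulVec_mulVec, nonsing_inv_mul _ hQ, one_mulVec]
  have ht {k l : ℕ} (N : Matrix (Fin k) (Fin l) ℝ) (a : Fin l → ℝ) (b : Fin k → ℝ) :
      a ⬝ᵥ Nᵀ *ᵥ b = b ⬝ᵥ N *ᵥ a := by
    rw [mulVec_transpose, dotProduct_comm, dotProduct_mulVec]
  have ht' {k l : ℕ} (N : Matrix (Fin k) (Fin l) ℝ) (a : Fin l → ℝ) (b : Fin k → ℝ) :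
      Nᵀ *ᵥ b ⬝ᵥ a = b ⬝ᵥ N *ᵥ a := by
    rw [dotProduct_comm, ht]
  have hMt (a b : Fin n → ℝ) : a ⬝ᵥ M *ᵥ b = b ⬝ᵥ M *ᵥ a := by
    conv_lhs => rw [← hM.eq]
    exact ht M a b
  have hSy : y ⬝ᵥ S *ᵥ u = C *ᵥ M *ᵥ z ⬝ᵥ S *ᵥ u + F *ᵥ u ⬝ᵥ S *ᵥ u := by
    rw [hy, add_dotProduct]
  have hyQ : Q *ᵥ y ⬝ᵥ y = Q *ᵥ y ⬝ᵥ C *ᵥ M *ᵥ z + Q *ᵥ y ⬝ᵥ F *ᵥ u := by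
    rw [← dotProduct_add, ← hy]
  rw [dissipativateLMI_eq_fromBlocks]
  simp only [fromBlocks_mulVec, Sum.elim_comp_inl, Sum.elim_comp_inr, fromCols_mulVec_sumElim,
    fromRows_mulVec, sumElim_dotProduct_sumElim, ← Sum.elim_add_add, add_mulVec, neg_mulVec,
    dotProduct_add, dotProduct_neg, ← mulVec_mulVec, hQy, ht, hMt z, ht', hSy]
  rw [dotProduct_comm y (Q *ᵥ y), dotProduct_comm (S *ᵥ u) (F *ᵥ u),
    dotProduct_comm (S *ᵥ u) (C *ᵥ M *ᵥ z)]
  linarith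

theorem HasDerivAt.dotProduct_mulVec_self {ι : Type*} [Fintype ι] {N : Matrix ι ι ℝ}
    (hN : N.IsSymm) {x : ℝ → ι → ℝ} {x' : ι → ℝ} {t : ℝ} (hx : HasDerivAt x x' t) :
    HasDerivAt (fun s => x s ⬝ᵥ N *ᵥ x s) (2 * (N *ᵥ x t ⬝ᵥ x')) t := by
  have hxi := hasDerivAt_pi.1 hx
  have hNx (i : ι) : HasDerivAt (fun s => (N *ᵥ x s) i) ((N *ᵥ x') i) t :=
    HasDerivAt.fun_sum fun j _ => (hxi j).const_mul (N i j)
  have h : HasDerivAt (fun s => x s ⬝ᵥ N *ᵥ x s) (x' ⬝ᵥ N *ᵥ x t + x t ⬝ᵥ N *ᵥ x') t := by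
    rw [dotProduct, dotProduct, ← Finset.sum_add_distrib]
    exact HasDerivAt.fun_sum fun i _ => (hxi i).mul (hNx i)
  convert h using 1
  rw [dotProduct_mulVec (x t), ← mulVec_transpose, hN.eq, dotProduct_comm x', two_mul]

/-- Feasibility of the dissipativate-ability LMI implies that with `K := L M⁻¹` the
closed-loop system `ẋ = (A + BK)x + Ew, y = Cx + Fw` is `(Q,S,R)`-dissipative from the
disturbance `w` to the output `y` with storage function `V(x) = xᵀM⁻¹x`. -/
theorem dissipativity_closedLoop_of_dissipativateLMI (n p q m : ℕ)
    (A : Matrix (Fin n) (Fin n) ℝ) (B : Matrix (Fin n) (Fin p) ℝ)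
    (E : Matrix (Fin n) (Fin q) ℝ) (C : Matrix (Fin m) (Fin n) ℝ)
    (F : Matrix (Fin m) (Fin q) ℝ) (M : Matrix (Fin n) (Fin n) ℝ)
    (L : Matrix (Fin p) (Fin n) ℝ) (Q : Matrix (Fin m) (Fin m) ℝ)
    (S : Matrix (Fin m) (Fin q) ℝ) (R : Matrix (Fin q) (Fin q) ℝ)
    (hM : M.PosDef) (hQ : Q.IsSymm) (hQneg : (-Q).PosDef) (hR : R.IsSymm)
    (hW : (dissipativateLMI A B E C F M L Q S R).PosSemidef) :
    ∀ w : ℝ → (Fin q → ℝ), Continuous w →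
    ∀ x : ℝ → (Fin n → ℝ),
      (∀ t : ℝ, HasDerivAt x
        ((A + B * (L * M⁻¹)).mulVec (x t) + E.mulVec (w t)) t) →
      ∀ t₀ t₁ : ℝ, t₀ ≤ t₁ →
        x t₁ ⬝ᵥ (M⁻¹).mulVec (x t₁) - x t₀ ⬝ᵥ (M⁻¹).mulVec (x t₀) ≤
          ∫ t in t₀..t₁,
            ((C.mulVec (x t) + F.mulVec (w t)) ⬝ᵥ
                Q.mulVec (C.mulVec (x t) + F.mulVec (w t)) +
              2 * ((C.mulVec (x t) + F.mulVec (w t)) ⬝ᵥ S.mulVec (w t)) +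
              w t ⬝ᵥ R.mulVec (w t)) := by
  intro w hw x hx t₀ t₁ ht
  have hMs : M.IsSymm := by simpa using hM.isHermitian
  have hMu : IsUnit M.det := hM.det_pos.ne'.isUnit
  have hQu : IsUnit Q.det := by
    rw [← Matrix.isUnit_iff_isUnit_det]
    simpa using hQneg.isUnit
  have hxc : Continuous x := continuous_iff_continuousAt.2 fun t => (hx t).continuousAt
  have hV t := (hx t).dotProduct_mulVec_self (N := M⁻¹) (by
    rw [Matrix.IsSymm, transpose_nonsing_inv, hMs.eq])
  rw [← integral_eq_sub_of_hasDerivAt (fun t _ => hV t)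
    (Continuous.intervalIntegrable (by fun_prop) _ _)]
  refine integral_mono_on ht (Continuous.intervalIntegrable (by fun_prop) _ _)
    (Continuous.intervalIntegrable (by fun_prop) _ _) fun t _ => ?_
  have hMx : M *ᵥ M⁻¹ *ᵥ x t = x t := by
    rw [mulVec_mulVec, mul_nonsing_inv _ hMu, one_mulVec]
  have h := dissipativateLMI_quadraticForm A B E C F hMs L hQu S R (M⁻¹ *ᵥ x t) (w t)
    (C *ᵥ x t + F *ᵥ w t) (by rw [hMx])
  have hpos := hW.dotProduct_mulVec_nonneg
    (Sum.elim (M⁻¹ *ᵥ x t) (Sum.elim (w t) (Q *ᵥ (C *ᵥ x t + F *ᵥ w t))))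
  rw [star_trivial, h, hMx] at hpos
  simp only [add_mulVec, ← mulVec_mulVec]
  linarith
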